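/- arXiv:math/0309385 — 10 statements merged into one kernel-verified Lean document; each statement's English description precedes it below -/
import Mathlib

section
/- Let p be a prime, let K' ⊆ K be fields of characteristic p, let A be a commutative K'-algebra, let B = A ⊗_{K'} K, and let q = p^r for some natural number r. Then the K-subalgebra of B generated by the set {b^q : b ∈ B} of q-th powers of elements of B is equal to the K-subalgebra of B generated by the set {a^q ⊗ 1 : a ∈ A}. -/
open TensorProduct

/-- Let `p` be a prime, `K' ⊆ K` fields of characteristic `p`, `A` a
commutative `K'`-algebra, `B = K ⊗[K'] A` the base change and `q = p ^ r`.  Then the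
`K`-subalgebra of `B` generated by the `q`-th powers of elements of `B` equals the
`K`-subalgebra generated by the elements `a ^ q ⊗ 1` for `a ∈ A`. -/
theorem adjoin_pow_q_eq (p : ℕ) (hp : p.Prime) (K' K A : Type*)
    [Field K'] [Field K] [Algebra K' K] [CharP K' p] [CharP K p]
    [CommRing A] [Algebra K' A] (r : ℕ) :
    Algebra.adjoin K {x : K ⊗[K'] A | ∃ b : K ⊗[K'] A, x = b ^ (p ^ r)} =
      Algebra.adjoin K {x : K ⊗[K'] A |
        ∃ a : A, x = Algebra.TensorProduct.includeRight (a ^ (p ^ r))} := by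
  apply le_antisymm
  · refine Algebra.adjoin_le ?_
    rintro _ ⟨b, rfl⟩
    induction b using TensorProduct.induction_on with
    | zero => simp [zero_pow (pow_ne_zero r hp.ne_zero)]
    | tmul k a =>
      have h : (k ⊗ₜ[K'] a) ^ p ^ r =
          k ^ p ^ r • (Algebra.TensorProduct.includeRight (a ^ p ^ r) : K ⊗[K'] A) := by
        simp [Algebra.TensorProduct.tmul_pow, TensorProduct.smul_tmul']
      rw [h]
      refine Subalgebra.smul_mem _ (Algebra.subset_adjoin ?_) _
      exact ⟨a, rfl⟩
    | add x y hx hy =>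
      have hp_zero : (p : K ⊗[K'] A) = 0 := by
        rw [← map_natCast (algebraMap K (K ⊗[K'] A)), CharP.cast_eq_zero, map_zero]
      obtain ⟨z, hz⟩ := exists_add_pow_prime_pow_eq hp x y r
      simp only [hp_zero, zero_mul, add_zero] at hz
      exact hz ▸ add_mem hx hy
  · refine Algebra.adjoin_mono ?_
    rintro _ ⟨a, rfl⟩
    exact ⟨Algebra.TensorProduct.includeRight a, map_pow _ _ _⟩
end

section
/- Let p be a prime, let K' be a perfect field of characteristic p, let A be a commutative K'-algebra which is an integral domain, and let q = p^r for some natural number r. If f_1, …, f_n are elements of A which are linearly independent over K', then f_1^q, …, f_n^q are also linearly independent over K'. -/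
/-- Let `p` be a prime, `K'` a perfect field of characteristic `p`,
`A` a commutative `K'`-algebra which is an integral domain, and `q = p ^ r`.  If
`f₁, …, fₙ ∈ A` are linearly independent over `K'`, then so are `f₁ ^ q, …, fₙ ^ q`. -/
theorem linearIndependent_pow_q (p : ℕ) (hp : p.Prime) (K' : Type*)
    [Field K'] [CharP K' p] [ExpChar K' p] [PerfectRing K' p]
    (A : Type*) [CommRing A] [IsDomain A] [Algebra K' A] (r : ℕ)
    (n : ℕ) (f : Fin n → A) (hf : LinearIndependent K' f) :
    LinearIndependent K' (fun i => f i ^ (p ^ r)) := by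
  have : ExpChar A p := expChar_of_injective_algebraMap (algebraMap K' A).injective p
  rw [Fintype.linearIndependent_iff] at hf ⊢
  intro g hg i
  obtain ⟨b, hb⟩ : ∃ b : Fin n → K', ∀ j, b j ^ p ^ r = g j :=
    ⟨fun j => (iterateFrobeniusEquiv K' p r).symm (g j),
      fun j => (iterateFrobeniusEquiv K' p r).apply_symm_apply (g j)⟩
  have hsum : (∑ j, b j • f j) ^ p ^ r = 0 := by
    rw [sum_pow_char_pow, ← hg]
    exact Finset.sum_congr rfl fun j _ => by rw [smul_pow, hb]
  rw [← hb i, hf b (eq_zero_of_pow_eq_zero hsum) i, zero_pow (pow_ne_zero r hp.ne_zero)]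
end

section
/- Let p be a prime, let K' be a perfect field of characteristic p, let K be a field extension of K', let A be a commutative K'-algebra which is an integral domain, and let q = p^r for some natural number r. Let A⟨r⟩ denote the twisted K'-algebra whose underlying ring is A and on which b ∈ K' acts as b^{p^{-r}} acts on A (this makes sense because the Frobenius b ↦ b^p is an automorphism of the perfect field K'). Then the assignment f ⊗ α ↦ (f^q ⊗ 1)·(1 ⊗ α) determines a well-defined K-algebra isomorphism from the base change A⟨r⟩ ⊗_{K'} K onto the K-subalgebra of A ⊗_{K'} K generated by the set {a^q ⊗ 1 : a ∈ A}. -/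
open TensorProduct

/-- The "Frobenius twist" `A⟨r⟩` of a `K'`-algebra `A` over a perfect field `K'` of
characteristic `p`: the same underlying ring as `A`, but where `b ∈ K'` acts the way
`b ^ (p ^ (-r))` acts on `A`. -/
def FrobTwist (K' : Type*) [Field K'] (p r : ℕ) [Fact p.Prime] [CharP K' p]
    [ExpChar K' p] [PerfectRing K' p]
    (A : Type*) [CommRing A] [Algebra K' A] : Type _ := A

namespace FrobTwist

variable (K' : Type*) [Field K'] (p r : ℕ) [Fact p.Prime] [CharP K' p]
  [ExpChar K' p] [PerfectRing K' p]
  (A : Type*) [CommRing A] [Algebra K' A]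

instance : CommRing (FrobTwist K' p r A) := inferInstanceAs (CommRing A)

/-- The identity of `A`, viewed as a map `A → A⟨r⟩`. -/
def of (a : A) : FrobTwist K' p r A := a

/-- The twisted `K'`-algebra structure: `b • x = b ^ (p ^ (-r)) • x`. -/
noncomputable instance : Algebra K' (FrobTwist K' p r A) :=
  ((algebraMap K' A).comp
    ((iterateFrobeniusEquiv K' p r).symm : K' →+* K')).toAlgebra

end FrobTwist

namespace FrobTwist

variable (K' : Type*) [Field K'] (p r : ℕ) [Fact p.Prime] [CharP K' p]
  [ExpChar K' p] [PerfectRing K' p]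
  (A : Type*) [CommRing A] [Algebra K' A]

/-- The `q`-power map, with `q = p ^ r`, as a `K'`-algebra homomorphism `A⟨r⟩ → A`. -/
noncomputable def powHom [ExpChar A p] : FrobTwist K' p r A →ₐ[K'] A where
  __ := (iterateFrobenius A p r : A →+* A)
  commutes' b := by
    change iterateFrobenius A p r (algebraMap K' A ((iterateFrobeniusEquiv K' p r).symm b)) =
      algebraMap K' A b
    rw [iterateFrobenius_def, ← map_pow, ← iterateFrobenius_def,
      ← iterateFrobeniusEquiv_apply, RingEquiv.apply_symm_apply]

theorem powHom_of [ExpChar A p] (a : A) : powHom K' p r A (of K' p r A a) = a ^ p ^ r :=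
  iterateFrobenius_def p r a

theorem powHom_injective [ExpChar A p] [IsReduced A] :
    Function.Injective (powHom K' p r A) :=
  iterateFrobenius_inj A p r

end FrobTwist

/-- The range of a base-changed algebra homomorphism is generated by the image of the original
homomorphism. -/
theorem range_tensorProductMap_id_eq_adjoin {R S B C : Type*} [CommRing R] [CommRing S]
    [CommRing B] [CommRing C] [Algebra R S] [Algebra R B] [Algebra R C] (g : B →ₐ[R] C) :
    (Algebra.TensorProduct.map (AlgHom.id S S) g).range =
      Algebra.adjoin S {x : S ⊗[R] C | ∃ b : B, x = Algebra.TensorProduct.includeRight (g b)} := by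
  apply le_antisymm
  · rintro _ ⟨x, rfl⟩
    induction x with
    | zero => exact zero_mem _
    | add x y hx hy => simpa using add_mem hx hy
    | tmul s b =>
      have h := Subalgebra.smul_mem _ (Algebra.subset_adjoin (R := S)
        (show Algebra.TensorProduct.includeRight (g b) ∈ {x : S ⊗[R] C |
          ∃ b : B, x = Algebra.TensorProduct.includeRight (g b)} from ⟨b, rfl⟩)) s
      simpa [TensorProduct.smul_tmul'] using h
  · refine Algebra.adjoin_le ?_
    rintro _ ⟨b, rfl⟩
    exact ⟨1 ⊗ₜ b, by simp⟩

/-- Let `p` be a prime, `K'` a perfect field of characteristic `p`,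
`K` an extension of `K'`, `A` a commutative `K'`-algebra which is a domain and
`q = p ^ r`.  The assignment `f ⊗ α ↦ (f ^ q ⊗ 1) · (1 ⊗ α)` determines a well-defined
`K`-algebra isomorphism from `K ⊗[K'] A⟨r⟩` onto the `K`-subalgebra of `K ⊗[K'] A`
generated by `{a ^ q ⊗ 1 : a ∈ A}`. -/
theorem frobTwist_baseChange_iso (p : ℕ) [Fact p.Prime] (K' K : Type*)
    [Field K'] [CharP K' p] [ExpChar K' p] [PerfectRing K' p]
    [Field K] [Algebra K' K]
    (A : Type*) [CommRing A] [IsDomain A] [Algebra K' A] (r : ℕ) :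
    ∃ e : (K ⊗[K'] FrobTwist K' p r A) ≃ₐ[K]
        (Algebra.adjoin K {x : K ⊗[K'] A |
          ∃ a : A, x = Algebra.TensorProduct.includeRight (a ^ (p ^ r))}),
      ∀ (f : A) (α : K),
        (e (α ⊗ₜ[K'] FrobTwist.of K' p r A f) : K ⊗[K'] A) =
          Algebra.TensorProduct.includeRight (f ^ (p ^ r)) *
            algebraMap K (K ⊗[K'] A) α := by
  have : ExpChar A p := expChar_of_injective_algebraMap (algebraMap K' A).injective p
  let g := FrobTwist.powHom K' p r A
  let φ := Algebra.TensorProduct.map (AlgHom.id K K) g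
  have hφ : Function.Injective φ :=
    Module.Flat.lTensor_preserves_injective_linearMap (M := K) g.toLinearMap
      (FrobTwist.powHom_injective K' p r A)
  refine ⟨(AlgEquiv.ofInjective φ hφ).trans
    (Subalgebra.equivOfEq _ _ (range_tensorProductMap_id_eq_adjoin g)), fun f α => ?_⟩
  change φ (α ⊗ₜ FrobTwist.of K' p r A f) = _
  simp [φ, g, FrobTwist.powHom_of, Algebra.TensorProduct.algebraMap_apply]
end

section
/- Let p be a prime, let K' be a perfect field of characteristic p, let K be a field extension of K', and let k be an algebraically closed field extension of K. Let A be a commutative K'-algebra such that A ⊗_{K'} k is an integral domain which is integrally closed in its field of fractions E, and let q = p^r for some natural number r. Regard A ⊗_{K'} K as a subring of A ⊗_{K'} k via the canonical injection. Then an element f ∈ A ⊗_{K'} K lies in the K-subalgebra of A ⊗_{K'} K generated by the set {a^q ⊗ 1 : a ∈ A} if and only if the image of f in E is a q-th power in E, i.e. f = g^q for some g ∈ E. -/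
open TensorProduct

/-- If the image of `f ∈ K ⊗ M` in `k ⊗ M` comes from `k ⊗ W` for a subspace `W` of `M`, then
`f` comes from `K ⊗ W`. -/
theorem TensorProduct.mem_range_lTensor_subtype_of_rTensor_mem {F K k M : Type*} [Field F]
    [AddCommGroup K] [Module F K] [AddCommGroup k] [Module F k] [AddCommGroup M] [Module F M]
    (φ : K →ₗ[F] k) (hφ : Function.Injective φ) (W : Submodule F M) (f : K ⊗[F] M)
    (h : φ.rTensor M f ∈ LinearMap.range (W.subtype.lTensor k)) :
    f ∈ LinearMap.range (W.subtype.lTensor K) := by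
  have hex : Function.Exact W.subtype W.mkQ := LinearMap.exact_subtype_mkQ W
  obtain ⟨y, hy⟩ := h
  refine (lTensor_exact K hex W.mkQ_surjective f).1 ?_
  apply Module.Flat.rTensor_preserves_injective_linearMap (M := M ⧸ W) φ hφ
  rw [map_zero, ← LinearMap.comp_apply, LinearMap.rTensor_comp_lTensor,
    ← LinearMap.lTensor_comp_rTensor, LinearMap.comp_apply]
  exact (lTensor_exact k hex W.mkQ_surjective _).2 ⟨y, hy⟩

/-- In exponential characteristic `p`, the `p ^ r`-th powers in `k ⊗ A` are sums of tensors
`c ⊗ a` with `a` in the linear span of the `p ^ r`-th powers in `A`. -/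
theorem TensorProduct.pow_expChar_pow_mem_range_lTensor_span {F k A : Type*} [Field F]
    [CommRing k] [Algebra F k] [CommRing A] [Algebra F A] (p : ℕ) [ExpChar (k ⊗[F] A) p]
    (r : ℕ) (g : k ⊗[F] A) :
    g ^ p ^ r ∈ LinearMap.range
      ((Submodule.span F (Set.range fun a : A => a ^ p ^ r)).subtype.lTensor k) := by
  induction g with
  | zero => rw [zero_pow (pow_ne_zero _ (expChar_ne_zero (k ⊗[F] A) p))]; exact zero_mem _
  | tmul c a =>
    rw [Algebra.TensorProduct.tmul_pow]
    exact ⟨(c ^ p ^ r) ⊗ₜ ⟨a ^ p ^ r, Submodule.subset_span ⟨a, rfl⟩⟩, by simp⟩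
  | add x y hx hy => rw [add_pow_expChar_pow]; exact add_mem hx hy

/-- Tensors `c ⊗ a` with `a` in the linear span of a set `S` lie in the `K`-algebra generated by
the image of `S`. -/
theorem TensorProduct.mem_adjoin_of_mem_range_lTensor_span {F K A : Type*} [Field F]
    [CommRing K] [Algebra F K] [CommRing A] [Algebra F A] (S : Set A) {f : K ⊗[F] A}
    (h : f ∈ LinearMap.range ((Submodule.span F S).subtype.lTensor K)) :
    f ∈ Algebra.adjoin K ((Algebra.TensorProduct.includeRight : A →ₐ[F] K ⊗[F] A) '' S) := by
  obtain ⟨y, rfl⟩ := h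
  induction y with
  | zero => rw [map_zero]; exact zero_mem _
  | add x y hx hy => rw [map_add]; exact add_mem hx hy
  | tmul c w =>
    obtain ⟨w, hw⟩ := w
    rw [LinearMap.lTensor_tmul, Submodule.subtype_apply]
    have key : (1 : K) ⊗ₜ[F] w ∈
        Algebra.adjoin K ((Algebra.TensorProduct.includeRight : A →ₐ[F] K ⊗[F] A) '' S) := by
      induction hw using Submodule.span_induction with
      | mem x hx => exact Algebra.subset_adjoin ⟨x, hx, rfl⟩
      | zero => rw [tmul_zero]; exact zero_mem _
      | add x y _ _ hx hy => rw [tmul_add]; exact add_mem hx hy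
      | smul t x _ hx =>
        rw [tmul_smul, ← algebraMap_smul K t]
        exact Subalgebra.smul_mem _ hx _
    simpa [smul_tmul'] using Subalgebra.smul_mem _ key c

/-- Let `p` be a prime, `K'` a perfect field of characteristic `p`,
`K'` ⊆ `K` ⊆ `k` field extensions with `k` algebraically closed, and `A` a commutative
`K'`-algebra such that `k ⊗[K'] A` is a domain integrally closed in its fraction field
`E`.  Let `q = p ^ r`.  Viewing `K ⊗[K'] A` inside `k ⊗[K'] A` via the canonical
injection, an element `f` of `K ⊗[K'] A` lies in the `K`-subalgebra generated by
`{a ^ q ⊗ 1 : a ∈ A}` if and only if the image of `f` in `E` is a `q`-th power. -/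
theorem mem_adjoin_pow_iff_isPowerInFractionField (p : ℕ) [Fact p.Prime]
    (K' K k : Type*) [Field K'] [CharP K' p] [ExpChar K' p] [PerfectRing K' p]
    [Field K] [Field k] [IsAlgClosed k]
    [Algebra K' K] [Algebra K k] [Algebra K' k] [IsScalarTower K' K k]
    (A : Type*) [CommRing A] [Algebra K' A]
    [IsDomain (k ⊗[K'] A)] [IsIntegrallyClosed (k ⊗[K'] A)]
    (r : ℕ) (f : K ⊗[K'] A) :
    f ∈ Algebra.adjoin K {x : K ⊗[K'] A |
        ∃ a : A, x = Algebra.TensorProduct.includeRight (a ^ (p ^ r))} ↔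
      ∃ g : FractionRing (k ⊗[K'] A),
        algebraMap (k ⊗[K'] A) (FractionRing (k ⊗[K'] A))
          (Algebra.TensorProduct.map (IsScalarTower.toAlgHom K' K k)
            (AlgHom.id K' A) f) = g ^ (p ^ r) := by
  have : ExpChar (k ⊗[K'] A) p :=
    expChar_of_injective_algebraMap (algebraMap K' (k ⊗[K'] A)).injective p
  have hq : p ^ r ≠ 0 := pow_ne_zero _ (Fact.out : p.Prime).ne_zero
  have hset : {x : K ⊗[K'] A |
      ∃ a : A, x = Algebra.TensorProduct.includeRight (a ^ (p ^ r))} =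
      (Algebra.TensorProduct.includeRight : A →ₐ[K'] K ⊗[K'] A) ''
        Set.range fun a : A => a ^ p ^ r := by
    ext x
    simp [eq_comm]
  constructor
  · intro hf
    suffices ∃ g : k ⊗[K'] A, Algebra.TensorProduct.map (IsScalarTower.toAlgHom K' K k)
        (AlgHom.id K' A) f = g ^ p ^ r by
      obtain ⟨g, hg⟩ := this
      exact ⟨algebraMap _ _ g, by rw [hg, map_pow]⟩
    induction hf using Algebra.adjoin_induction with
    | mem x hx =>
      obtain ⟨a, rfl⟩ := hx
      exact ⟨1 ⊗ₜ a, by simp [Algebra.TensorProduct.tmul_pow]⟩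
    | algebraMap c =>
      obtain ⟨d, hd⟩ := IsAlgClosed.exists_pow_nat_eq (algebraMap K k c) (Nat.pos_of_ne_zero hq)
      exact ⟨d ⊗ₜ 1, by simp [Algebra.TensorProduct.tmul_pow, hd]⟩
    | add x y _ _ hx hy =>
      obtain ⟨⟨g, hg⟩, ⟨h, hh⟩⟩ := And.intro hx hy
      exact ⟨g + h, by rw [map_add, hg, hh, add_pow_expChar_pow]⟩
    | mul x y _ _ hx hy =>
      obtain ⟨⟨g, hg⟩, ⟨h, hh⟩⟩ := And.intro hx hy
      exact ⟨g * h, by rw [map_mul, hg, hh, mul_pow]⟩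
  · rintro ⟨g, hg⟩
    obtain ⟨g, rfl⟩ := IsIntegrallyClosed.exists_algebraMap_eq_of_isIntegral_pow
      (R := k ⊗[K'] A) (Nat.pos_of_ne_zero hq) (hg ▸ isIntegral_algebraMap)
    rw [← map_pow] at hg
    replace hg := IsFractionRing.injective (k ⊗[K'] A) (FractionRing (k ⊗[K'] A)) hg
    rw [hset]
    apply TensorProduct.mem_adjoin_of_mem_range_lTensor_span
    apply TensorProduct.mem_range_lTensor_subtype_of_rTensor_mem
      (IsScalarTower.toAlgHom K' K k).toLinearMap (algebraMap K k).injective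
    have := TensorProduct.pow_expChar_pow_mem_range_lTensor_span p r g
    rwa [← hg] at this
end

section
/- Let k be an algebraically closed field of characteristic p > 0, let F be a finitely generated field extension of k, and let E be an intermediate field, k ⊆ E ⊆ F, which contains at least one element transcendental over k. Then there exists a unique natural number r such that every element of E is a p^r-th power in F, but not every element of E is a p^{r+1}-th power in F. -/
open Polynomial IntermediateField

/-- A transcendental element `y` does not lie in the field generated by `y ^ q` when `1 < q`. -/
theorem Transcendental.notMem_adjoin_simple_pow {L F : Type*} [Field L] [Field F] [Algebra L F]
    {y : F} (hy : Transcendental L y) {q : ℕ} (hq : 1 < q) : y ∉ L⟮y ^ q⟯ := by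
  intro hmem
  obtain ⟨r, s, hrs⟩ := (mem_adjoin_simple_iff L y).mp hmem
  have hs : Polynomial.aeval (y ^ q) s ≠ 0 := by
    intro h
    rw [h, div_zero] at hrs
    exact hy (hrs ▸ isAlgebraic_zero)
  have hs0 : s ≠ 0 := by
    rintro rfl
    simp at hs
  have hq0 : 0 < q := by omega
  have heq : X * expand L q s = expand L q r := by
    apply transcendental_iff_injective.mp hy
    rw [map_mul, aeval_X, expand_aeval, expand_aeval]
    exact (eq_div_iff hs).mp hrs
  have hdeg := congrArg natDegree heq
  rw [natDegree_X_mul ((expand_ne_zero hq0).mpr hs0), natDegree_expand, natDegree_expand] at hdeg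
  have hdvd : q ∣ 1 := (Nat.dvd_add_right (dvd_mul_left q s.natDegree)).mp
    (hdeg ▸ dvd_mul_left q r.natDegree)
  exact hq.ne' (Nat.dvd_one.mp hdvd)

/-- If `F` is finite over `L⟮x⟯` with `x` transcendental over `L`, then `x` is not infinitely
`p`-divisible in the multiplicative sense. -/
theorem Transcendental.exists_forall_pow_ne_of_finiteDimensional {L F : Type*} [Field L] [Field F]
    [Algebra L F] (p : ℕ) [Fact p.Prime] [CharP F p] {x : F} (hx : Transcendental L x)
    [FiniteDimensional L⟮x⟯ F] : ∃ n : ℕ, ∀ y : F, y ^ p ^ n ≠ x := by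
  have hp : p.Prime := Fact.out
  induction hd : Module.finrank L⟮x⟯ F using Nat.strong_induction_on generalizing x with
  | _ d ih =>
  by_cases h : ∃ y : F, y ^ p = x
  · obtain ⟨y, rfl⟩ := h
    have hy : Transcendental L y := fun h ↦ hx (h.pow p)
    have hle : L⟮y ^ p⟯ ≤ L⟮y⟯ :=
      adjoin_simple_le_iff.mpr (pow_mem (mem_adjoin_simple_self L y) p)
    have hlt : L⟮y ^ p⟯ < L⟮y⟯ := lt_of_le_not_ge hle fun hge ↦
      hy.notMem_adjoin_simple_pow hp.one_lt (hge (mem_adjoin_simple_self L y))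
    have : FiniteDimensional L⟮y⟯ F := by
      let := (inclusion hle).toAlgebra
      have : IsScalarTower L⟮y ^ p⟯ L⟮y⟯ F := .of_algebraMap_eq' rfl
      exact .right L⟮y ^ p⟯ L⟮y⟯ F
    obtain ⟨n, hn⟩ := ih _ (hd ▸ finrank_lt_of_gt hlt) hy rfl
    refine ⟨n + 1, fun z hz ↦ hn z (frobenius_inj F p ?_)⟩
    simpa [frobenius_def, ← pow_mul, ← pow_succ] using hz
  · push Not at h
    exact ⟨1, by simpa using h⟩

/-- In a finitely generated field extension of characteristic `p`, no transcendental element is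
a `p ^ n`-th power for all `n`. -/
theorem Transcendental.exists_forall_pow_ne {k F : Type*} [Field k] [Field F] [Algebra k F]
    [Algebra.EssFiniteType k F] (p : ℕ) [Fact p.Prime] [CharP F p] {x : F}
    (hx : Transcendental k x) : ∃ n : ℕ, ∀ y : F, y ^ p ^ n ≠ x := by
  obtain ⟨B, hxB, hB⟩ := exists_isTranscendenceBasis_superset (R := k) (s := {x})
    ((algebraicIndependent_singleton_iff (x := fun i : ({x} : Set F) ↦ (i : F)) ⟨x, rfl⟩).mpr hx)
  have hxB : x ∈ B := hxB rfl
  have hins : insert x (B \ {x}) = B := Set.insert_sdiff_self_of_mem hxB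
  let L := adjoin k (B \ {x})
  have hxL : Transcendental L x := by
    have h := ((AlgebraicIndepOn.insert_iff (R := k) (x := id) (s := B \ {x}) (i := x)
      (by simp)).mp (by rw [hins]; exact hB.1)).2
    rw [Set.image_id] at h
    exact fun h' ↦ h (isAlgebraic_adjoin_iff.mp h')
  have : Algebra.EssFiniteType L F := .of_comp k _ _
  have : Algebra.EssFiniteType L⟮x⟯ F := .of_comp L _ _
  have hle : adjoin k B ≤ L⟮x⟯.restrictScalars k := by
    rw [adjoin_le_iff, ← hins, Set.insert_subset_iff]
    exact ⟨mem_adjoin_simple_self L x, fun b hb ↦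
      L⟮x⟯.algebraMap_mem ⟨b, subset_adjoin k _ hb⟩⟩
  have : Algebra.IsAlgebraic (adjoin k B) F := by
    have h := hB.isAlgebraic_field
    rwa [Subtype.range_coe] at h
  have : Algebra.IsAlgebraic L⟮x⟯ F := ⟨fun z ↦
    (Algebra.IsAlgebraic.isAlgebraic (R := adjoin k B) z).tower_top_of_subalgebra_le
      (B := (L⟮x⟯.restrictScalars k).toSubalgebra) hle⟩
  have : FiniteDimensional L⟮x⟯ F := Algebra.finite_of_essFiniteType_of_isAlgebraic
  exact hxL.exists_forall_pow_ne_of_finiteDimensional p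

/-- Let `k` be an algebraically closed field of characteristic `p > 0`,
`F` a finitely generated field extension of `k`, and `E` an intermediate field
`k ⊆ E ⊆ F` containing an element transcendental over `k`.  Then there is a unique
`r : ℕ` such that every element of `E` is a `p ^ r`-th power in `F`, but not every
element of `E` is a `p ^ (r + 1)`-th power in `F`. -/
theorem exists_unique_frobenius_height (p : ℕ) (hp : p.Prime)
    (k F : Type*) [Field k] [Field F] [Algebra k F] [IsAlgClosed k] [CharP k p]
    (hfg : ∃ s : Finset F, IntermediateField.adjoin k (s : Set F) = ⊤)
    (E : IntermediateField k F)
    (htr : ∃ x ∈ E, Transcendental k x) :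
    ∃! r : ℕ,
      (∀ x ∈ E, ∃ y : F, y ^ (p ^ r) = x) ∧
        ¬ (∀ x ∈ E, ∃ y : F, y ^ (p ^ (r + 1)) = x) := by
  classical
  have : Fact p.Prime := ⟨hp⟩
  have : CharP F p := charP_of_injective_algebraMap (algebraMap k F).injective p
  have : Algebra.EssFiniteType k F := fg_top_iff.mp hfg
  obtain ⟨x, hxE, hx⟩ := htr
  have hex : ∃ n : ℕ, ¬ ∀ x ∈ E, ∃ y : F, y ^ p ^ n = x := by
    obtain ⟨n, hn⟩ := hx.exists_forall_pow_ne p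
    exact ⟨n, fun h ↦ (h x hxE).elim hn⟩
  have hanti : ∀ m n : ℕ, m ≤ n → (∀ x ∈ E, ∃ y : F, y ^ p ^ n = x) →
      ∀ x ∈ E, ∃ y : F, y ^ p ^ m = x := by
    intro m n hmn h x hxE
    obtain ⟨y, rfl⟩ := h x hxE
    exact ⟨y ^ p ^ (n - m), by rw [← pow_mul, ← pow_add, Nat.sub_add_cancel hmn]⟩
  obtain ⟨r, hr⟩ : ∃ r, Nat.find hex = r + 1 := by
    refine Nat.exists_eq_succ_of_ne_zero fun h ↦ ?_
    have := Nat.find_spec hex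
    rw [h] at this
    exact this fun x _ ↦ ⟨x, by simp⟩
  refine ⟨r, ⟨not_not.mp (Nat.find_min hex (by omega)), hr ▸ Nat.find_spec hex⟩, ?_⟩
  rintro s ⟨hs, hs'⟩
  have h₁ : Nat.find hex ≤ s + 1 := Nat.find_min' hex hs'
  have h₂ : s < Nat.find hex := lt_of_not_ge fun h ↦ Nat.find_spec hex (hanti _ _ h hs)
  omega
end

section
/- Let p be a prime, let K' be a perfect field of characteristic p, let K be a field extension of K', and let k be an algebraically closed field extension of K. Let A be a finitely generated commutative K'-algebra such that A ⊗_{K'} k is an integral domain which is integrally closed in its field of fractions, let B be a commutative K-algebra which is an integral domain, and let φ : B → A ⊗_{K'} K be a K-algebra homomorphism such that some element of the image of φ, viewed in A ⊗_{K'} k via the canonical injection, is transcendental over k. Then there exists a unique natural number r such that the image of φ is contained in the K-subalgebra of A ⊗_{K'} K generated by {a^{p^r} ⊗ 1 : a ∈ A}, but the image of φ is not contained in the K-subalgebra generated by {a^{p^{r+1}} ⊗ 1 : a ∈ A}. -/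
open TensorProduct

/-- In a Noetherian domain, an element with `p ^ r`-th roots for all `r` is zero or a unit. -/
theorem eq_zero_or_isUnit_of_forall_exists_pow_eq {R : Type*} [CommRing R] [IsDomain R]
    [IsNoetherianRing R] (p : ℕ) [Fact p.Prime] [CharP R p] {f : R}
    (hf : ∀ r : ℕ, ∃ g : R, g ^ p ^ r = f) : f = 0 ∨ IsUnit f := by
  have hp : p.Prime := Fact.out
  choose g hg using hf
  have hstep : ∀ r, g (r + 1) ^ p = g r := by
    intro r
    apply iterateFrobenius_inj R p r
    simp only [iterateFrobenius_def]
    rw [hg, ← pow_mul, ← pow_succ', hg]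
  have hmono : Monotone fun r => Ideal.span {g r} := by
    refine monotone_nat_of_le_succ fun r => ?_
    rw [Ideal.span_singleton_le_span_singleton, ← hstep r]
    exact dvd_pow_self _ hp.ne_zero
  obtain ⟨n, hn⟩ := monotone_stabilizes_iff_noetherian.mpr ‹IsNoetherianRing R› ⟨_, hmono⟩
  have hle : Ideal.span {g (n + 1)} ≤ Ideal.span {g n} := (hn (n + 1) n.le_succ).ge
  rw [Ideal.span_singleton_le_span_singleton, ← hstep n] at hle
  rw [← hg (n + 1)]
  rcases eq_or_ne (g (n + 1)) 0 with h0 | h0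
  · left
    rw [h0, zero_pow (pow_ne_zero _ hp.ne_zero)]
  · right
    refine IsUnit.pow _ ?_
    by_contra hu
    have := (pow_dvd_pow_iff h0 hu (n := p) (m := 1)).mp (by simpa using hle)
    exact absurd hp.one_lt (not_lt.mpr this)

/-- In a finitely generated algebra which is a domain over an algebraically closed field `k`, an
element with `p ^ r`-th roots for all `r` is a constant. -/
theorem mem_range_algebraMap_of_forall_exists_pow_eq {k R : Type*} [Field k] [IsAlgClosed k]
    [CommRing R] [IsDomain R] [Algebra k R] [Algebra.FiniteType k R] (p : ℕ) [Fact p.Prime]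
    [CharP k p] {f : R} (hf : ∀ r : ℕ, ∃ g : R, g ^ p ^ r = f) :
    f ∈ (algebraMap k R).range := by
  have hp : p.Prime := Fact.out
  have : CharP R p := charP_of_injective_algebraMap (algebraMap k R).injective p
  have : IsNoetherianRing R := Algebra.FiniteType.isNoetherianRing k R
  obtain ⟨m, hm⟩ := Ideal.exists_maximal R
  let _ : Field (R ⧸ m) := Ideal.Quotient.field m
  have : Module.Finite k (R ⧸ m) := finite_of_finite_type_of_isJacobsonRing k (R ⧸ m)
  obtain ⟨c, hc⟩ := (IsAlgClosed.algebraMap_bijective_of_isIntegral (k := k) (K := R ⧸ m)).2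
    (Ideal.Quotient.mk m f)
  have hmem : f - algebraMap k R c ∈ m := by
    rw [← Ideal.Quotient.eq_zero_iff_mem, map_sub, ← hc, sub_eq_zero]
    rfl
  have hroots : ∀ r : ℕ, ∃ g : R, g ^ p ^ r = f - algebraMap k R c := by
    intro r
    obtain ⟨g, rfl⟩ := hf r
    obtain ⟨d, rfl⟩ := IsAlgClosed.exists_pow_nat_eq c (pow_pos hp.pos r)
    exact ⟨g - algebraMap k R d, by rw [sub_pow_char_pow, map_pow]⟩
  rcases eq_zero_or_isUnit_of_forall_exists_pow_eq p hroots with h | h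
  · exact ⟨c, (sub_eq_zero.mp h).symm⟩
  · exact absurd (Ideal.eq_top_of_isUnit_mem _ hmem h) hm.ne_top

/-- Over an algebraically closed field, the elements of the algebra generated by `p ^ r`-th powers
are `p ^ r`-th powers. -/
theorem exists_pow_eq_map_of_mem_adjoin_pow (p : ℕ) [Fact p.Prime]
    {K' K k A : Type*} [Field K'] [Field K] [Field k] [IsAlgClosed k] [CharP k p]
    [Algebra K' K] [Algebra K k] [Algebra K' k] [IsScalarTower K' K k]
    [CommRing A] [Algebra K' A] [CharP (k ⊗[K'] A) p] {r : ℕ} {x : K ⊗[K'] A}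
    (hx : x ∈ Algebra.adjoin K {x : K ⊗[K'] A |
      ∃ a : A, x = Algebra.TensorProduct.includeRight (a ^ (p ^ r))}) :
    ∃ g : k ⊗[K'] A, g ^ p ^ r = Algebra.TensorProduct.map (IsScalarTower.toAlgHom K' K k)
      (AlgHom.id K' A) x := by
  have hp : p.Prime := Fact.out
  induction hx using Algebra.adjoin_induction with
  | mem x hx =>
    obtain ⟨a, rfl⟩ := hx
    exact ⟨1 ⊗ₜ a, by simp [Algebra.TensorProduct.tmul_pow]⟩
  | algebraMap c =>
    obtain ⟨d, hd⟩ := IsAlgClosed.exists_pow_nat_eq (algebraMap K k c) (pow_pos hp.pos r)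
    exact ⟨d ⊗ₜ 1, by
      simp [Algebra.TensorProduct.tmul_pow, hd, Algebra.TensorProduct.algebraMap_apply]⟩
  | add x y _ _ hx hy =>
    obtain ⟨g, hg⟩ := hx
    obtain ⟨h, hh⟩ := hy
    exact ⟨g + h, by rw [add_pow_char_pow, hg, hh, map_add]⟩
  | mul x y _ _ hx hy =>
    obtain ⟨g, hg⟩ := hx
    obtain ⟨h, hh⟩ := hy
    exact ⟨g * h, by rw [mul_pow, hg, hh, map_mul]⟩

/-- The algebras generated by `p ^ r`-th powers decrease with `r`. -/
theorem antitone_adjoin_pow (p : ℕ) (K' K A : Type*) [CommRing K'] [CommRing K] [Algebra K' K]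
    [CommRing A] [Algebra K' A] :
    Antitone fun r : ℕ => Algebra.adjoin K {x : K ⊗[K'] A |
      ∃ a : A, x = Algebra.TensorProduct.includeRight (a ^ (p ^ r))} := by
  intro r s hrs
  refine Algebra.adjoin_mono ?_
  rintro _ ⟨a, rfl⟩
  exact ⟨a ^ p ^ (s - r), by rw [← pow_mul, ← pow_add, Nat.sub_add_cancel hrs]⟩

/-- The pure tensors `1 ⊗ a` generate the base change of an algebra. -/
theorem mem_adjoin_includeRight {K' K A : Type*} [CommRing K'] [CommRing K] [Algebra K' K]
    [CommRing A] [Algebra K' A] (x : K ⊗[K'] A) :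
    x ∈ Algebra.adjoin K {x : K ⊗[K'] A |
      ∃ a : A, x = Algebra.TensorProduct.includeRight a} := by
  induction x using TensorProduct.induction_on with
  | zero => exact zero_mem _
  | add x y hx hy => exact add_mem hx hy
  | tmul c a =>
    have h : c ⊗ₜ[K'] a = c • (Algebra.TensorProduct.includeRight a : K ⊗[K'] A) := by
      simp [TensorProduct.smul_tmul']
    rw [h]
    exact Subalgebra.smul_mem _ (Algebra.subset_adjoin (by exact ⟨a, rfl⟩)) c

/-- Let `p` be a prime, `K'` a perfect field of characteristic `p`,
`K'` ⊆ `K` ⊆ `k` fields with `k` algebraically closed.  Let `A` be a finitely generated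
commutative `K'`-algebra such that `k ⊗[K'] A` is a domain, integrally closed in its
fraction field, let `B` be a commutative `K`-algebra domain, and let
`φ : B → K ⊗[K'] A` be a `K`-algebra homomorphism such that some element of its image,
viewed in `k ⊗[K'] A`, is transcendental over `k`.  Then there is a unique `r : ℕ` such
that the image of `φ` lies in the `K`-subalgebra generated by `{a ^ (p ^ r) ⊗ 1}`, but
not in the `K`-subalgebra generated by `{a ^ (p ^ (r + 1)) ⊗ 1}`. -/
theorem exists_unique_frobenius_factorization (p : ℕ) [Fact p.Prime]
    (K' K k : Type*) [Field K'] [CharP K' p] [ExpChar K' p] [PerfectRing K' p]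
    [Field K] [Field k] [IsAlgClosed k]
    [Algebra K' K] [Algebra K k] [Algebra K' k] [IsScalarTower K' K k]
    (A : Type*) [CommRing A] [Algebra K' A] [Algebra.FiniteType K' A]
    [IsDomain (k ⊗[K'] A)] [IsIntegrallyClosed (k ⊗[K'] A)]
    (B : Type*) [CommRing B] [IsDomain B] [Algebra K B]
    (φ : B →ₐ[K] K ⊗[K'] A)
    (htr : ∃ b : B, Transcendental k
      (Algebra.TensorProduct.map (IsScalarTower.toAlgHom K' K k)
        (AlgHom.id K' A) (φ b))) :
    ∃! r : ℕ,
      (∀ b : B, φ b ∈ Algebra.adjoin K {x : K ⊗[K'] A |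
          ∃ a : A, x = Algebra.TensorProduct.includeRight (a ^ (p ^ r))}) ∧
        ¬ (∀ b : B, φ b ∈ Algebra.adjoin K {x : K ⊗[K'] A |
          ∃ a : A, x = Algebra.TensorProduct.includeRight (a ^ (p ^ (r + 1)))}) := by
  have : CharP k p := charP_of_injective_algebraMap (algebraMap K' k).injective p
  have : CharP (k ⊗[K'] A) p :=
    charP_of_injective_algebraMap (algebraMap k (k ⊗[K'] A)).injective p
  have hanti := antitone_adjoin_pow p K' K A
  obtain ⟨b, hb⟩ := htr
  have hex : ∃ r : ℕ, ¬ ∀ b : B, φ b ∈ Algebra.adjoin K {x : K ⊗[K'] A |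
      ∃ a : A, x = Algebra.TensorProduct.includeRight (a ^ (p ^ r))} := by
    by_contra! hall
    obtain ⟨c, hc⟩ := mem_range_algebraMap_of_forall_exists_pow_eq (k := k) p
      fun r => exists_pow_eq_map_of_mem_adjoin_pow (k := k) p (hall r b)
    exact hb (hc ▸ isAlgebraic_algebraMap c)
  classical
  have hpos : Nat.find hex ≠ 0 := by
    intro h0
    refine Nat.find_spec hex fun b => ?_
    simpa only [h0, pow_zero, pow_one] using mem_adjoin_includeRight (φ b)
  obtain ⟨n, hn⟩ := Nat.exists_eq_succ_of_ne_zero hpos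
  have hmem := not_not.mp (Nat.find_min hex (m := n) (by lia))
  have hnot := Nat.find_spec hex
  rw [hn] at hnot
  refine ⟨n, ⟨hmem, hnot⟩, ?_⟩
  rintro s ⟨hs, hs'⟩
  refine le_antisymm ?_ ?_
  · by_contra! h
    exact hnot fun b => hanti (show n + 1 ≤ s from h) (hs b)
  · by_contra! h
    exact hs' fun b => hanti (show s + 1 ≤ n from h) (hmem b)
end

section
/- Let k be an algebraically closed field of characteristic p > 0 and let n ≥ 1. Let φ : k → GL_n(k) be a map satisfying φ(0) = 1 and φ(s + t) = φ(s)·φ(t) for all s, t ∈ k, whose matrix entries are polynomial functions: there is an n × n matrix P of polynomials over k with (φ(s))_{ij} = P_{ij}(s) for all s, i, j. Assume φ is not the constant map 1. Then there exist a unique natural number r and a unique map ψ : k → GL_n(k), also satisfying ψ(0) = 1 and ψ(s+t) = ψ(s)ψ(t) and having polynomial entries Q_{ij}, such that φ(s) = ψ(s^{p^r}) for all s ∈ k and such that the matrix of derivatives (Q_{ij}'(0))_{ij} is not the zero matrix. -/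
open Polynomial in
/-- If the derivative at `0` of a matrix-valued polynomial map that is additive-to-multiplicative
vanishes, then so does its derivative everywhere. -/
theorem Matrix.derivative_eq_zero_of_eval_add {k ι : Type*} [Field k] [Infinite k] [Fintype ι]
    (P : Matrix ι ι k[X])
    (hadd : ∀ (s t : k) (i j : ι),
      (P i j).eval (s + t) = ∑ l, (P i l).eval s * (P l j).eval t)
    (h0 : ∀ i j, (P i j).derivative.eval 0 = 0) (i j : ι) : (P i j).derivative = 0 := by
  refine Polynomial.funext fun s => ?_
  have h : (P i j).comp (X + C s) = ∑ l, C ((P i l).eval s) * P l j := by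
    refine Polynomial.funext fun t => ?_
    simp [eval_finsetSum, add_comm t s, hadd]
  have h' := congrArg (fun q => q.derivative.eval 0) h
  simpa [derivative_comp, derivative_sum, eval_finsetSum, h0] using h'

open Polynomial in
/-- A nontrivial polynomial homomorphism from the additive group to `GL` factors through some power
of Frobenius as a polynomial homomorphism with nonzero derivative at `0`. -/
theorem exists_frobenius_untwist_Ga {k ι : Type*} (p : ℕ) [Fact p.Prime] [Field k]
    [IsAlgClosed k] [CharP k p] [Fintype ι] [DecidableEq ι]
    (φ : k → GL ι k) (P : Matrix ι ι k[X])
    (hφ0 : φ 0 = 1) (hφadd : ∀ s t, φ (s + t) = φ s * φ t)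
    (hP : ∀ s i j, (φ s : Matrix ι ι k) i j = (P i j).eval s)
    (hnc : φ ≠ fun _ => 1) :
    ∃ (r : ℕ) (ψ : k → GL ι k), ψ 0 = 1 ∧ (∀ s t, ψ (s + t) = ψ s * ψ t) ∧
      (∃ Q : Matrix ι ι k[X], (∀ s i j, (ψ s : Matrix ι ι k) i j = (Q i j).eval s) ∧
        ¬ ∀ i j, (Q i j).derivative.eval 0 = 0) ∧
      ∀ s, φ s = ψ (s ^ p ^ r) := by
  have hp : p.Prime := Fact.out
  induction hN : ∑ i, ∑ j, (P i j).natDegree using Nat.strong_induction_on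
    generalizing φ P with
  | _ N ih =>
  by_cases h0 : ∀ i j, (P i j).derivative.eval 0 = 0
  swap
  · exact ⟨0, φ, hφ0, hφadd, ⟨P, hP, h0⟩, by simp⟩
  have hPadd (s t : k) (i j : ι) :
      (P i j).eval (s + t) = ∑ l, (P i l).eval s * (P l j).eval t := by
    simp only [← hP, hφadd, Units.val_mul, Matrix.mul_apply]
  have hexp (i j : ι) : expand k p (contract p (P i j)) = P i j :=
    expand_contract p (Matrix.derivative_eq_zero_of_eval_add P hPadd h0 i j) hp.ne_zero
  have hdeg : N = (∑ i, ∑ j, (contract p (P i j)).natDegree) * p := by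
    simp only [← hN, Finset.sum_mul, ← natDegree_expand, hexp]
  have hNpos : N ≠ 0 := by
    rintro rfl
    apply hnc
    ext s i j
    have hd : (P i j).natDegree = 0 := by
      simp only [Finset.sum_eq_zero_iff, Finset.mem_univ, true_imp_iff] at hN
      exact hN i j
    rw [← hφ0, hP, hP, eq_C_of_natDegree_eq_zero hd, eval_C, eval_C]
  let F := (frobeniusEquiv k p).symm
  have hF (s : k) : F (s ^ p) = s := frobeniusEquiv_symm_apply_frobenius k p s
  have hF' (s : k) : F s ^ p = s := frobenius_apply_frobeniusEquiv_symm k p s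
  obtain ⟨r, ψ, hψ0, hψadd, hQ, hψ⟩ := ih (∑ i, ∑ j, (contract p (P i j)).natDegree)
    (by have := hp.two_le; nlinarith [Nat.pos_of_ne_zero hNpos])
    (fun s => φ (F s)) (fun i j => contract p (P i j))
    (by simp [hφ0]) (by simp [hφadd])
    (fun s i j => by rw [hP, ← hexp, expand_eval, hF', hexp])
    (fun h => hnc (funext fun s => by simpa [hF] using congrFun h (s ^ p))) rfl
  refine ⟨r + 1, ψ, hψ0, hψadd, hQ, fun s => ?_⟩
  rw [pow_succ', pow_mul, ← hψ, hF]

open Polynomial in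
/-- A map with polynomial entries and nonzero derivative at `0` is determined by any of its Frobenius
twists, and it cannot be a Frobenius twist of another such map. -/
theorem frobenius_untwist_unique_of_le {k ι : Type*} {p : ℕ} (hp : p.Prime) [Field k]
    [IsAlgClosed k] [CharP k p] [Fintype ι] [DecidableEq ι] {r r' : ℕ} (hle : r ≤ r')
    {ψ ψ' : k → GL ι k} {Q Q' : Matrix ι ι k[X]}
    (hQ : ∀ s i j, (ψ s : Matrix ι ι k) i j = (Q i j).eval s)
    (hQ' : ∀ s i j, (ψ' s : Matrix ι ι k) i j = (Q' i j).eval s)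
    (hd : ¬ ∀ i j, (Q i j).derivative.eval 0 = 0)
    (h : ∀ s, ψ (s ^ p ^ r) = ψ' (s ^ p ^ r')) : r = r' ∧ ψ = ψ' := by
  obtain ⟨d, rfl⟩ := Nat.exists_eq_add_of_le hle
  have hψ (u : k) : ψ u = ψ' (u ^ p ^ d) := by
    obtain ⟨s, rfl⟩ := IsAlgClosed.exists_pow_nat_eq u (pow_pos hp.pos r)
    rw [h, pow_add, pow_mul]
  rcases Nat.eq_zero_or_pos d with rfl | hpos
  · exact ⟨rfl, funext fun u => by simpa using hψ u⟩
  · refine absurd (fun i j => ?_) hd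
    have hQQ : Q i j = expand k (p ^ d) (Q' i j) :=
      Polynomial.funext fun u => by rw [← hQ, hψ, hQ', expand_eval]
    rw [hQQ, derivative_expand]
    simp [hpos.ne']

/-- Let `k` be an algebraically closed field of characteristic `p > 0`
and `n ≥ 1`.  Let `φ : k → GLₙ(k)` be a non-constant homomorphism from the additive
group of `k` whose matrix entries are polynomial functions.  Then there is a unique
pair `(r, ψ)` where `ψ : k → GLₙ(k)` is again an additive-to-multiplicative
homomorphism with polynomial entries `Q`, such that `φ(s) = ψ(s ^ (p ^ r))` for all
`s` and the matrix of derivatives `(Qᵢⱼ'(0))` is not zero. -/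
theorem exists_unique_frobenius_untwist_Ga (p : ℕ) (hp : p.Prime)
    (k : Type*) [Field k] [IsAlgClosed k] [CharP k p]
    (n : ℕ) (hn : 1 ≤ n)
    (φ : k → GL (Fin n) k)
    (hφ0 : φ 0 = 1)
    (hφadd : ∀ s t : k, φ (s + t) = φ s * φ t)
    (hpoly : ∃ P : Matrix (Fin n) (Fin n) (Polynomial k),
      ∀ (s : k) (i j : Fin n), (φ s : Matrix (Fin n) (Fin n) k) i j = (P i j).eval s)
    (hnc : φ ≠ fun _ => 1) :
    ∃! rψ : ℕ × (k → GL (Fin n) k),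
      rψ.2 0 = 1 ∧
      (∀ s t : k, rψ.2 (s + t) = rψ.2 s * rψ.2 t) ∧
      (∃ Q : Matrix (Fin n) (Fin n) (Polynomial k),
        (∀ (s : k) (i j : Fin n),
          (rψ.2 s : Matrix (Fin n) (Fin n) k) i j = (Q i j).eval s) ∧
        ¬ (∀ i j : Fin n, ((Q i j).derivative.eval 0 = 0))) ∧
      (∀ s : k, φ s = rψ.2 (s ^ (p ^ rψ.1))) := by
  have : Fact p.Prime := ⟨hp⟩
  obtain ⟨P, hP⟩ := hpoly
  obtain ⟨r, ψ, hψ0, hψadd, ⟨Q, hQ, hd⟩, hψ⟩ :=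
    exists_frobenius_untwist_Ga p φ P hφ0 hφadd hP hnc
  refine ⟨(r, ψ), ⟨hψ0, hψadd, ⟨Q, hQ, hd⟩, hψ⟩, ?_⟩
  rintro ⟨r', ψ'⟩ ⟨-, -, ⟨Q', hQ', hd'⟩, hψ'⟩
  dsimp only at hQ' hψ'
  rcases le_total r r' with hle | hle
  · obtain ⟨rfl, rfl⟩ := frobenius_untwist_unique_of_le hp hle hQ hQ' hd
      fun s => (hψ s).symm.trans (hψ' s)
    rfl
  · obtain ⟨rfl, rfl⟩ := frobenius_untwist_unique_of_le hp hle hQ' hQ hd'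
      fun s => (hψ' s).symm.trans (hψ s)
    rfl
end

section
/- Let k be an algebraically closed field and let n ≥ 1. Let φ₁, φ₂ : SL₂(k) → GL_n(k) be group homomorphisms which are polynomial in the matrix entries: for m = 1, 2 there is an n × n matrix P^{(m)} of polynomials in four variables over k such that (φ_m(g))_{ij} = P^{(m)}_{ij}(g₁₁, g₁₂, g₂₁, g₂₂) for every g ∈ SL₂(k) with entries g₁₁, g₁₂, g₂₁, g₂₂. If φ₁(b) = φ₂(b) for every upper-triangular matrix b ∈ SL₂(k) (i.e. every b with b₂₁ = 0), then φ₁ = φ₂. -/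
open Polynomial in
/-- A polynomial which agrees with a polynomial in the inverse variable is constant, and the two
constants coincide. -/
theorem Polynomial.eval_eq_eval_zero_of_eval_eq_eval_inv {k : Type*} [Field k] [Infinite k]
    {p q : k[X]} (h : ∀ t : k, t ≠ 0 → p.eval t = q.eval t⁻¹) (s : k) :
    q.eval s = p.eval 0 := by
  have eq_of_ne {f g : k[X]} (hfg : ∀ t : k, t ≠ 0 → f.eval t = g.eval t) : f = g :=
    Polynomial.eq_of_infinite_eval_eq f g <|
      (Set.finite_singleton (0 : k)).infinite_compl.mono fun t ht => hfg t ht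
  have hrev : X ^ q.natDegree * p = q.reverse := by
    refine eq_of_ne fun t ht => ?_
    let _ : Invertible t⁻¹ := invertibleOfNonzero (inv_ne_zero ht)
    have hq := eval₂_reverse_mul_pow (RingHom.id k) t⁻¹ q
    rw [invOf_eq_inv, inv_inv, eval₂_id, eval₂_id, ← h t ht] at hq
    rw [eval_mul, eval_pow, eval_X, ← hq, mul_comm, mul_assoc, ← mul_pow, inv_mul_cancel₀ ht,
      one_pow, mul_one]
  have hp : p.natDegree = 0 := by
    rcases eq_or_ne p 0 with rfl | hp
    · simp
    · have hdeg := q.reverse_natDegree_le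
      rw [← hrev, natDegree_mul (pow_ne_zero _ X_ne_zero) hp, natDegree_X_pow] at hdeg
      omega
  obtain ⟨c, rfl⟩ := natDegree_eq_zero.mp hp
  have hq : q = C c := eq_of_ne fun t ht => by
    rw [← inv_inv t, ← h _ (inv_ne_zero ht), eval_C, eval_C]
  simp [hq]

open Polynomial in
/-- The ratio of two polynomial maps out of `SL₂` is polynomial along a polynomial curve. -/
theorem Matrix.SpecialLinearGroup.exists_polynomial_matrix_mul_inv {k : Type*} [Field k] {n : ℕ}
    {φ₁ φ₂ : Matrix.SpecialLinearGroup (Fin 2) k →* GL (Fin n) k}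
    (hpoly₁ : ∃ P : Matrix (Fin n) (Fin n) (MvPolynomial (Fin 2 × Fin 2) k),
      ∀ (g : Matrix.SpecialLinearGroup (Fin 2) k) (i j : Fin n),
        (φ₁ g : Matrix (Fin n) (Fin n) k) i j =
          MvPolynomial.eval (fun q => (g : Matrix (Fin 2) (Fin 2) k) q.1 q.2) (P i j))
    (hpoly₂ : ∃ P : Matrix (Fin n) (Fin n) (MvPolynomial (Fin 2 × Fin 2) k),
      ∀ (g : Matrix.SpecialLinearGroup (Fin 2) k) (i j : Fin n),
        (φ₂ g : Matrix (Fin n) (Fin n) k) i j =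
          MvPolynomial.eval (fun q => (g : Matrix (Fin 2) (Fin 2) k) q.1 q.2) (P i j))
    (G : Matrix.SpecialLinearGroup (Fin 2) k[X]) :
    ∃ M : Matrix (Fin n) (Fin n) k[X], ∀ (t : k) (i j : Fin n),
      (φ₁ (G.map (evalRingHom t)) * (φ₂ (G.map (evalRingHom t)))⁻¹ : GL (Fin n) k) i j =
        (M i j).eval t := by
  have pullback (P : MvPolynomial (Fin 2 × Fin 2) k) (H : Matrix.SpecialLinearGroup (Fin 2) k[X])
      (t : k) : MvPolynomial.eval (fun q => (H.map (evalRingHom t)) q.1 q.2) P =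
        (MvPolynomial.aeval (fun q => H q.1 q.2) P).eval t := by
    induction P using MvPolynomial.induction_on with
    | C a => simp
    | add p q hp hq => rw [map_add, map_add, eval_add, hp, hq]
    | mul_X p i hp => rw [map_mul, map_mul, eval_mul, hp]; simp
  obtain ⟨P₁, h₁⟩ := hpoly₁
  obtain ⟨P₂, h₂⟩ := hpoly₂
  refine ⟨(Matrix.of fun i j => MvPolynomial.aeval (fun q => G q.1 q.2) (P₁ i j)) *
    Matrix.of fun i j => MvPolynomial.aeval (fun q => G⁻¹ q.1 q.2) (P₂ i j), fun t i j => ?_⟩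
  rw [← map_inv, ← map_inv, Units.val_mul, Matrix.mul_apply, Matrix.mul_apply, eval_finsetSum]
  refine Finset.sum_congr rfl fun l _ => ?_
  rw [h₁, h₂, pullback, pullback, eval_mul, Matrix.of_apply, Matrix.of_apply]

/-- Let `k` be an algebraically closed field and `n ≥ 1`.  Two group
homomorphisms `SL₂(k) → GLₙ(k)` which are polynomial in the matrix entries and agree
on all upper-triangular matrices of `SL₂(k)` are equal. -/
theorem sl2_hom_eq_of_eq_on_borel (k : Type*) [Field k] [IsAlgClosed k]
    (n : ℕ) (hn : 1 ≤ n)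
    (φ₁ φ₂ : Matrix.SpecialLinearGroup (Fin 2) k →* GL (Fin n) k)
    (hpoly₁ : ∃ P : Matrix (Fin n) (Fin n) (MvPolynomial (Fin 2 × Fin 2) k),
      ∀ (g : Matrix.SpecialLinearGroup (Fin 2) k) (i j : Fin n),
        (φ₁ g : Matrix (Fin n) (Fin n) k) i j =
          MvPolynomial.eval (fun q => (g : Matrix (Fin 2) (Fin 2) k) q.1 q.2) (P i j))
    (hpoly₂ : ∃ P : Matrix (Fin n) (Fin n) (MvPolynomial (Fin 2 × Fin 2) k),
      ∀ (g : Matrix.SpecialLinearGroup (Fin 2) k) (i j : Fin n),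
        (φ₂ g : Matrix (Fin n) (Fin n) k) i j =
          MvPolynomial.eval (fun q => (g : Matrix (Fin 2) (Fin 2) k) q.1 q.2) (P i j))
    (hB : ∀ b : Matrix.SpecialLinearGroup (Fin 2) k,
      (b : Matrix (Fin 2) (Fin 2) k) 1 0 = 0 → φ₁ b = φ₂ b) :
    φ₁ = φ₂ := by
  have ratio_eq {g h : Matrix.SpecialLinearGroup (Fin 2) k} (hgh : (h⁻¹ * g) 1 0 = 0) :
      φ₁ g * (φ₂ g)⁻¹ = φ₁ h * (φ₂ h)⁻¹ := by
    have hb := hB _ hgh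
    rw [map_mul, map_mul, map_inv, map_inv] at hb
    rw [mul_inv_eq_iff_eq_mul, mul_assoc, ← hb, mul_inv_cancel_left]
  let U : Matrix.SpecialLinearGroup (Fin 2) (Polynomial k) :=
    ⟨!![1, 0; Polynomial.X, 1], by simp [Matrix.det_fin_two]⟩
  let V : Matrix.SpecialLinearGroup (Fin 2) (Polynomial k) :=
    ⟨!![Polynomial.X, -1; 1, 0], by simp [Matrix.det_fin_two]⟩
  have coe_U (t : k) : (U.map (Polynomial.evalRingHom t) : Matrix (Fin 2) (Fin 2) k) =
      !![1, 0; t, 1] := by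
    ext i j
    rw [Matrix.SpecialLinearGroup.map_apply_coe]
    fin_cases i <;> fin_cases j <;> simp [U]
  have coe_V (s : k) : (V.map (Polynomial.evalRingHom s) : Matrix (Fin 2) (Fin 2) k) =
      !![s, -1; 1, 0] := by
    ext i j
    rw [Matrix.SpecialLinearGroup.map_apply_coe]
    fin_cases i <;> fin_cases j <;> simp [V]
  obtain ⟨M, hM⟩ :=
    Matrix.SpecialLinearGroup.exists_polynomial_matrix_mul_inv hpoly₁ hpoly₂ U
  obtain ⟨N, hN⟩ :=
    Matrix.SpecialLinearGroup.exists_polynomial_matrix_mul_inv hpoly₁ hpoly₂ V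
  have hMN (i j : Fin n) (t : k) (ht : t ≠ 0) : (M i j).eval t = (N i j).eval t⁻¹ := by
    rw [← hM, ← hN, ratio_eq]
    simp [coe_U, coe_V, Matrix.SpecialLinearGroup.coe_inv, Matrix.adjugate_fin_two, ht]
  have hU : U.map (Polynomial.evalRingHom (0 : k)) = 1 :=
    Subtype.ext <| by simp [coe_U, Matrix.one_fin_two]
  have hV (s : k) : φ₁ (V.map (Polynomial.evalRingHom s)) *
      (φ₂ (V.map (Polynomial.evalRingHom s)))⁻¹ = 1 := by
    ext i j
    rw [hN, Polynomial.eval_eq_eval_zero_of_eval_eq_eval_inv (hMN i j), ← hM, hU, map_one,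
      map_one, inv_one, mul_one]
  ext1 g
  by_cases hg : g 1 0 = 0
  · exact hB g hg
  · rw [← mul_inv_eq_one, ← hV (g 0 0 / g 1 0)]
    refine ratio_eq ?_
    simp [coe_V, Matrix.SpecialLinearGroup.coe_inv, Matrix.adjugate_fin_two, Matrix.mul_apply]
    field_simp
    ring
end

section
/- Let k be a field and let V be a k-vector space equipped with an internal direct sum decomposition V = ⊕_{i ∈ ℤ} V_i indexed by the integers. Let f : V → V be a k-linear map with f(V_i) ⊆ V_{i+2} for all i ∈ ℤ. Assume that the subspace ⊕_{i ≥ 1} V_i is contained in the image under f of the subspace ⊕_{i ≥ -1} V_i. Then for every integer n ≥ 1 with V_n ≠ 0, the iterate f^{⌈n/2⌉} is a nonzero linear map; that is, f^{n/2} ≠ 0 when n is even and f^{(n+1)/2} ≠ 0 when n is odd. -/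
open DirectSum in
/-- A linear map of degree `d` commutes with taking homogeneous components, up to the shift
by `d`. -/
theorem decompose_map_add {R M : Type*} [Semiring R] [AddCommMonoid M] [Module R M]
    (A : ℤ → Submodule R M) [Decomposition A] (f : Module.End R M) (d : ℤ)
    (hf : ∀ i, (A i).map f ≤ A (i + d)) (y : M) (i : ℤ) :
    (decompose A (f y) (i + d) : M) = f (decompose A y i) := by
  induction y using Decomposition.inductionOn A with
  | zero => simp
  | @homogeneous j m =>
    have hm : f m ∈ A (j + d) := hf j (Submodule.mem_map_of_mem m.2)
    by_cases hij : j = i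
    · subst hij
      rw [decompose_of_mem_same A hm, decompose_of_mem_same A m.2]
    · rw [decompose_of_mem_ne A hm (by lia), decompose_of_mem_ne A m.2 hij, map_zero]
  | add a b ha hb => simp [ha, hb]

/-- If a homogeneous component lies in the range of a linear map of degree `d`, then it lies in
the image of the component `d` steps below. -/
theorem DirectSum.IsInternal.le_map_of_le_range {R M : Type*} [Semiring R] [AddCommMonoid M]
    [Module R M] {A : ℤ → Submodule R M} (hA : DirectSum.IsInternal A) {f : Module.End R M}
    {d : ℤ} (hf : ∀ i, (A i).map f ≤ A (i + d)) {i : ℤ} (h : A (i + d) ≤ LinearMap.range f) :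
    A (i + d) ≤ (A i).map f := by
  let _ : DirectSum.Decomposition A := hA.chooseDecomposition
  intro x hx
  obtain ⟨y, rfl⟩ := h hx
  refine ⟨DirectSum.decompose A y i, SetLike.coe_mem _, ?_⟩
  rw [← decompose_map_add A f d hf, DirectSum.decompose_of_mem_same A hx]

/-- If `A (i + d)` is contained in the image of `A i` for all `i ≥ a`, then `A (i + m * d)` is
contained in the image of `A i` under the `m`-th iterate. -/
theorem Submodule.le_map_pow_of_le_map {R M : Type*} [Semiring R] [AddCommMonoid M]
    [Module R M] {A : ℤ → Submodule R M} {f : Module.End R M} {a d : ℤ} (hd : 0 ≤ d)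
    (h : ∀ i, a ≤ i → A (i + d) ≤ (A i).map f) (m : ℕ) {i : ℤ} (hi : a ≤ i) :
    A (i + m * d) ≤ (A i).map (f ^ m) := by
  induction m with
  | zero => simp [Module.End.one_eq_id]
  | succ m ih =>
    have hm : a ≤ i + m * d := hi.trans (le_add_of_nonneg_right (by positivity))
    calc A (i + (m + 1 : ℕ) * d) = A (i + m * d + d) := by congr 1; push_cast; ring
      _ ≤ (A (i + m * d)).map f := h _ hm
      _ ≤ ((A i).map (f ^ m)).map f := Submodule.map_mono ih
      _ = (A i).map (f ^ (m + 1)) := by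
        rw [pow_succ', Module.End.mul_eq_comp, Submodule.map_comp]

/-- Let `V = ⊕_{i ∈ ℤ} V_i` be a `ℤ`-graded vector space over a field
`k` and `f : V → V` a linear map of degree `2`, i.e. `f (V_i) ⊆ V_{i+2}`.  If
`⊕_{i ≥ 1} V_i` is contained in the image under `f` of `⊕_{i ≥ -1} V_i`, then for every
`n ≥ 1` with `V_n ≠ 0` the iterate `f ^ ⌈n/2⌉` is nonzero: `f ^ (n/2) ≠ 0` for even `n`
and `f ^ ((n+1)/2) ≠ 0` for odd `n`. -/
theorem pow_ne_zero_of_graded_surjective (k V : Type*) [Field k] [AddCommGroup V]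
    [Module k V] (Vi : ℤ → Submodule k V) (hV : DirectSum.IsInternal Vi)
    (f : Module.End k V)
    (hf : ∀ i : ℤ, (Vi i).map f ≤ Vi (i + 2))
    (hsurj : (⨆ i ∈ Set.Ici (1 : ℤ), Vi i) ≤
      Submodule.map f (⨆ i ∈ Set.Ici (-1 : ℤ), Vi i)) :
    ∀ n : ℤ, 1 ≤ n → Vi n ≠ ⊥ →
      (Even n → f ^ (n / 2).toNat ≠ 0) ∧ (Odd n → f ^ ((n + 1) / 2).toNat ≠ 0) := by
  have hstep : ∀ i : ℤ, -1 ≤ i → Vi (i + 2) ≤ (Vi i).map f := fun i hi =>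
    hV.le_map_of_le_range hf <|
      (le_iSup₂_of_le (f := fun j (_ : j ∈ Set.Ici (1 : ℤ)) => Vi j) (i + 2)
        (Set.mem_Ici.2 (by lia)) le_rfl).trans (hsurj.trans LinearMap.map_le_range)
  intro n hn hne
  have key : ∀ m : ℕ, -1 ≤ n - m * 2 → f ^ m ≠ 0 := by
    intro m hm h0
    have hle := Submodule.le_map_pow_of_le_map (by norm_num) hstep m hm
    rw [sub_add_cancel, h0, Submodule.map_zero] at hle
    exact hne (le_bot_iff.1 hle)
  exact ⟨fun _ => key _ (by lia), fun _ => key _ (by lia)⟩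
end

section
/- Let k be a field, let n ≥ 1, and let a₁, …, a_{n-1} ∈ k with a₁ ≠ 0. Define f(u) = Σ_{i=1}^{n-1} a_i (u - 1)^i for an n × n matrix u over k. Then f maps the set of unipotent elements of SL_n(k), namely {u ∈ SL_n(k) : (u - 1)^n = 0}, bijectively onto the set of nilpotent n × n matrices over k, namely {X : X^n = 0}; moreover f is equivariant for conjugation: f(g u g^{-1}) = g f(u) g^{-1} for every g ∈ SL_n(k) and every unipotent u ∈ SL_n(k). -/
open Polynomial in
/-- A polynomial `X * p` with `p(0) ≠ 0` has, modulo any power of `X`, a left inverse for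
composition, again of the form `X * q` with `q(0) ≠ 0`. -/
theorem Polynomial.exists_X_pow_dvd_mul_comp_sub_one {k : Type*} [Field k] (p : k[X])
    (hp : p.eval 0 ≠ 0) (m : ℕ) :
    ∃ q : k[X], q.eval 0 ≠ 0 ∧ X ^ (m + 1) ∣ p * q.comp (X * p) - 1 := by
  induction m with
  | zero =>
    refine ⟨C (p.eval 0)⁻¹, by simpa using hp, ?_⟩
    rw [zero_add, pow_one, X_dvd_iff, coeff_zero_eq_eval_zero]
    simp [hp]
  | succ m ih =>
    obtain ⟨q, hq, s, hs⟩ := ih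
    refine ⟨q - C (s.eval 0 / p.eval 0 ^ (m + 2)) * X ^ (m + 1), by simpa using hq, ?_⟩
    have key : p * (q - C (s.eval 0 / p.eval 0 ^ (m + 2)) * X ^ (m + 1)).comp (X * p) - 1 =
        X ^ (m + 1) * (s - C (s.eval 0 / p.eval 0 ^ (m + 2)) * p ^ (m + 2)) := by
      simp only [sub_comp, mul_comp, C_comp, pow_comp, X_comp]
      linear_combination hs
    rw [key, pow_succ X (m + 1)]
    refine mul_dvd_mul_left _ ?_
    rw [X_dvd_iff, coeff_zero_eq_eval_zero]
    simp [hp]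

open Polynomial in
theorem Polynomial.aeval_X_mul_aeval_X_mul_of_pow_eq_zero {k A : Type*} [Field k] [Ring A]
    [Algebra k A] {p q : k[X]} {n : ℕ} (h : X ^ n ∣ p * q.comp (X * p) - 1) {e : A}
    (he : e ^ n = 0) : aeval (aeval e (X * p)) (X * q) = e := by
  obtain ⟨s, hs⟩ := h
  have key : (X * q).comp (X * p) = X + X ^ n * (X * s) := by
    simp only [mul_comp, X_comp]
    linear_combination X * hs
  rw [← aeval_comp, key]
  simp [he]

open Polynomial in
theorem Polynomial.aeval_X_mul_pow_eq_zero {k A : Type*} [Field k] [Ring A]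
    [Algebra k A] (p : k[X]) {n : ℕ} {e : A} (he : e ^ n = 0) : aeval e (X * p) ^ n = 0 := by
  rw [← map_pow, mul_pow, map_mul, map_pow, aeval_X, he, zero_mul]

theorem Matrix.det_one_add_of_isNilpotent {k ι : Type*} [Field k] [Fintype ι] [DecidableEq ι]
    {e : Matrix ι ι k} (he : IsNilpotent e) : (1 + e).det = 1 := by
  have h := (Matrix.isNilpotent_charpoly_sub_pow_of_isNilpotent he.neg).eq_zero
  have h1 := congrArg (Polynomial.eval 1) (sub_eq_zero.mp h)
  simpa [Matrix.eval_charpoly] using h1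

open Polynomial in
theorem Polynomial.aeval_X_mul_sum_of_pow_eq_zero {k A : Type*} [Field k] [Ring A] [Algebra k A]
    {n : ℕ} (hn : 1 ≤ n) (a : ℕ → k) {e : A} (he : e ^ n = 0) :
    aeval e (X * ∑ i ∈ Finset.range n, C (a (i + 1)) * X ^ i) =
      ∑ i ∈ Finset.Icc 1 (n - 1), a i • e ^ i := by
  obtain ⟨m, rfl⟩ := Nat.exists_eq_add_of_le' hn
  have hI : Finset.Icc 1 m = Finset.Ico 1 (m + 1) := by
    ext
    simp
  rw [Nat.add_sub_cancel, hI, Finset.sum_Ico_eq_sum_range, Finset.sum_range_succ]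
  simp only [mul_add, map_add, map_mul, map_sum, aeval_X, aeval_C, map_pow, Finset.mul_sum,
    Nat.add_sub_cancel]
  have h0 : ∀ i, e * (algebraMap k A (a (i + 1)) * e ^ i) = a (i + 1) • e ^ (i + 1) := by
    intro i
    rw [← Algebra.smul_def, mul_smul_comm, pow_succ']
  simp [h0, he, add_comm 1]


/-- Let `k` be a field, `n ≥ 1`, and `a₁, …, a_{n-1} ∈ k` with
`a₁ ≠ 0`.  The map `u ↦ Σ_{i=1}^{n-1} aᵢ (u - 1)^i` carries the set of unipotent
elements of `SLₙ(k)` bijectively onto the set of nilpotent `n × n` matrices over `k`,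
and it is equivariant for conjugation (a Springer isomorphism for `SLₙ`). -/
theorem springer_map_bijOn_and_equivariant (k : Type*) [Field k]
    (n : ℕ) (hn : 1 ≤ n) (a : ℕ → k) (ha : a 1 ≠ 0) :
    Set.BijOn
      (fun u : Matrix.SpecialLinearGroup (Fin n) k =>
        ∑ i ∈ Finset.Icc 1 (n - 1),
          a i • ((u : Matrix (Fin n) (Fin n) k) - 1) ^ i)
      {u : Matrix.SpecialLinearGroup (Fin n) k |
        ((u : Matrix (Fin n) (Fin n) k) - 1) ^ n = 0}
      {X : Matrix (Fin n) (Fin n) k | X ^ n = 0} ∧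
    ∀ g u : Matrix.SpecialLinearGroup (Fin n) k,
      ((u : Matrix (Fin n) (Fin n) k) - 1) ^ n = 0 →
      (∑ i ∈ Finset.Icc 1 (n - 1),
          a i • (((g * u * g⁻¹ : Matrix.SpecialLinearGroup (Fin n) k) :
            Matrix (Fin n) (Fin n) k) - 1) ^ i) =
        (g : Matrix (Fin n) (Fin n) k) *
          (∑ i ∈ Finset.Icc 1 (n - 1),
            a i • ((u : Matrix (Fin n) (Fin n) k) - 1) ^ i) *
          ((g⁻¹ : Matrix.SpecialLinearGroup (Fin n) k) : Matrix (Fin n) (Fin n) k) := by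
  set p : Polynomial k :=
    ∑ i ∈ Finset.range n, Polynomial.C (a (i + 1)) * Polynomial.X ^ i with hp_def
  have hp : p.eval 0 ≠ 0 := by
    have : p.eval 0 = a 1 := by
      rw [hp_def, Polynomial.eval_finsetSum, Finset.sum_eq_single 0]
      · simp
      · intro i _ hi
        simp [hi]
      · intro h
        simp at h
        omega
    rwa [this]
  have hf : ∀ e : Matrix (Fin n) (Fin n) k, e ^ n = 0 →
      ∑ i ∈ Finset.Icc 1 (n - 1), a i • e ^ i = Polynomial.aeval e (Polynomial.X * p) :=
    fun e he => (Polynomial.aeval_X_mul_sum_of_pow_eq_zero hn a he).symm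
  obtain ⟨q, hq, hpq⟩ := p.exists_X_pow_dvd_mul_comp_sub_one hp (n - 1)
  obtain ⟨r, -, hqr⟩ := q.exists_X_pow_dvd_mul_comp_sub_one hq (n - 1)
  rw [Nat.sub_add_cancel hn] at hpq hqr
  refine ⟨⟨?_, ?_, ?_⟩, ?_⟩
  · intro u (hu : _ = _)
    change _ ^ n = 0
    dsimp only
    rw [hf _ hu]
    exact Polynomial.aeval_X_mul_pow_eq_zero p hu
  · intro u (hu : _ = _) v (hv : _ = _) (huv : _ = _)
    dsimp only at huv
    rw [hf _ hu, hf _ hv] at huv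
    have h := congrArg (fun x => Polynomial.aeval x (Polynomial.X * q)) huv
    rw [Polynomial.aeval_X_mul_aeval_X_mul_of_pow_eq_zero hpq hu,
      Polynomial.aeval_X_mul_aeval_X_mul_of_pow_eq_zero hpq hv] at h
    exact Subtype.ext (sub_left_injective h)
  · intro x (hx : _ = _)
    set e := Polynomial.aeval x (Polynomial.X * q) with he_def
    have he : e ^ n = 0 := Polynomial.aeval_X_mul_pow_eq_zero q hx
    refine ⟨⟨1 + e, Matrix.det_one_add_of_isNilpotent ⟨n, he⟩⟩, ?_, ?_⟩
    · change (1 + e - 1) ^ n = 0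
      rwa [add_sub_cancel_left]
    · simp only [add_sub_cancel_left]
      rw [hf _ he]
      have h1 := Polynomial.aeval_X_mul_aeval_X_mul_of_pow_eq_zero hqr hx
      have h2 := Polynomial.aeval_X_mul_aeval_X_mul_of_pow_eq_zero hqr
        (Polynomial.aeval_X_mul_pow_eq_zero p he)
      rw [Polynomial.aeval_X_mul_aeval_X_mul_of_pow_eq_zero hpq he] at h2
      exact h2.symm.trans h1
  · intro g u _
    have hg : (g : Matrix (Fin n) (Fin n) k) * (g⁻¹ : Matrix.SpecialLinearGroup (Fin n) k) = 1 := by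
      rw [← Matrix.SpecialLinearGroup.coe_mul, mul_inv_cancel, Matrix.SpecialLinearGroup.coe_one]
    have hg' : ((g⁻¹ : Matrix.SpecialLinearGroup (Fin n) k) : Matrix (Fin n) (Fin n) k) * g = 1 := by
      rw [← Matrix.SpecialLinearGroup.coe_mul, inv_mul_cancel, Matrix.SpecialLinearGroup.coe_one]
    rw [Finset.mul_sum, Finset.sum_mul]
    refine Finset.sum_congr rfl fun i _ => ?_
    rw [mul_smul_comm, smul_mul_assoc]
    congr 1
    let w : (Matrix (Fin n) (Fin n) k)ˣ := ⟨g, (g⁻¹ : Matrix.SpecialLinearGroup (Fin n) k), hg, hg'⟩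
    refine Eq.trans ?_ (w.conj_pow _ i)
    congr 1
    change _ = (g : Matrix (Fin n) (Fin n) k) * _ * (g⁻¹ : Matrix.SpecialLinearGroup (Fin n) k)
    rw [Matrix.SpecialLinearGroup.coe_mul, Matrix.SpecialLinearGroup.coe_mul, mul_sub, sub_mul,
      mul_one, hg]
end
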